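/- arXiv:2208.06095 — 5 statements merged into one kernel-verified Lean document; each statement's English description precedes it below -/
import Mathlib

section
/- Let τ₀ ≥ 0, Λ_T ≥ 0, Λ_P ≥ 0, Λ_F > 0 and λ > 0 be real constants, and let h(k) = τ₀ + Λ_T·k + (1/λ)·exp(Λ_F·k) + Λ_P·k·exp(Λ_F·k). Then the function k ↦ h(k)/k² is convex on the interval (0, ∞). -/
/-- The exponential of a convex function is convex. -/
theorem ConvexOn.real_exp_comp {s : Set ℝ} {g : ℝ → ℝ} (hg : ConvexOn ℝ s g) :
    ConvexOn ℝ s (fun x => Real.exp (g x)) :=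
  ⟨hg.1, fun _ hx _ hy _ _ ha hb hab =>
    (Real.exp_le_exp.2 (hg.2 hx hy ha hb hab)).trans
      (convexOn_exp.2 (Set.mem_univ _) (Set.mem_univ _) ha hb hab)⟩

/-- `x ↦ exp (c * x) / x ^ n` is log-convex, hence convex, on the positive half-line. -/
theorem convexOn_exp_mul_div_pow (c : ℝ) (n : ℕ) :
    ConvexOn ℝ (Set.Ioi (0 : ℝ)) (fun x : ℝ => Real.exp (c * x) / x ^ n) := by
  have hlin : ConvexOn ℝ (Set.Ioi (0 : ℝ)) (fun x : ℝ => c * x) :=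
    (LinearMap.mulLeft ℝ c).convexOn (convex_Ioi 0)
  have hlog : ConvexOn ℝ (Set.Ioi (0 : ℝ)) (fun x : ℝ => (n : ℝ) * -Real.log x) :=
    strictConcaveOn_log_Ioi.concaveOn.neg.smul n.cast_nonneg
  refine (hlin.add hlog).real_exp_comp.congr fun x hx => ?_
  have hx : 0 < x := hx
  simp only [Pi.add_apply]
  rw [mul_neg, ← sub_eq_add_neg, Real.exp_sub, Real.exp_nat_mul, Real.exp_log hx]

/-- With h(k) = τ₀ + Λ_T·k + (1/λ)·exp(Λ_F·k) + Λ_P·k·exp(Λ_F·k),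
the function k ↦ h(k)/k² is convex on (0, ∞). -/
theorem convexOn_timeCost_div_sq (τ₀ ΛT ΛP ΛF lam : ℝ)
    (hτ : 0 ≤ τ₀) (hT : 0 ≤ ΛT) (hP : 0 ≤ ΛP) (hF : 0 < ΛF) (hlam : 0 < lam) :
    ConvexOn ℝ (Set.Ioi (0 : ℝ))
      (fun k : ℝ => (τ₀ + ΛT * k + (1 / lam) * Real.exp (ΛF * k)
        + ΛP * k * Real.exp (ΛF * k)) / k ^ 2) := by
  refine (((((convexOn_exp_mul_div_pow 0 2).smul hτ).add
    ((convexOn_exp_mul_div_pow 0 1).smul hT)).add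
    ((convexOn_exp_mul_div_pow ΛF 2).smul (one_div_pos.2 hlam).le)).add
    ((convexOn_exp_mul_div_pow ΛF 1).smul hP)).congr fun k hk => ?_
  have hk : k ≠ 0 := ne_of_gt hk
  simp only [Pi.add_apply, smul_eq_mul, zero_mul, Real.exp_zero]
  field_simp
end

section
/- Let τ₀ ≥ 0, Λ_T ≥ 0, Λ_P ≥ 0, Λ_F > 0 and λ > 0 be real constants, and let h(k) = τ₀ + Λ_T·k + (1/λ)·exp(Λ_F·k) + Λ_P·k·exp(Λ_F·k). Then the function k ↦ h(k)/k^(4/3) is convex on the interval (0, ∞). -/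
/-- The function `x ↦ exp (a * x) * x ^ (-p)` is log-convex, hence convex, on `(0, ∞)`. -/
lemma convexOn_exp_mul_rpow_neg (a : ℝ) {p : ℝ} (hp : 0 ≤ p) :
    ConvexOn ℝ (Set.Ioi (0 : ℝ)) (fun x : ℝ => Real.exp (a * x) * x ^ (-p)) := by
  have hexp : ∀ x : ℝ, 0 < x →
      Real.exp (a * x) * x ^ (-p) = Real.exp (a * x - p * Real.log x) := by
    intro x hx
    rw [Real.rpow_def_of_pos hx, ← Real.exp_add]
    ring_nf
  refine ⟨convex_Ioi 0, fun x hx y hy s t hs ht hst => ?_⟩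
  have hpos := convex_Ioi (0 : ℝ) hx hy hs ht hst
  have hlog := strictConcaveOn_log_Ioi.concaveOn.2 hx hy hs ht hst
  have hconv := convexOn_exp.2 (Set.mem_univ (a * x - p * Real.log x))
    (Set.mem_univ (a * y - p * Real.log y)) hs ht hst
  simp only [smul_eq_mul, Set.mem_Ioi] at *
  rw [hexp _ hpos, hexp x hx, hexp y hy]
  refine (Real.exp_le_exp.2 ?_).trans hconv
  linarith [mul_le_mul_of_nonneg_left hlog hp]

/-- With h(k) = τ₀ + Λ_T·k + (1/λ)·exp(Λ_F·k) + Λ_P·k·exp(Λ_F·k),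
the function k ↦ h(k)/k^(4/3) is convex on (0, ∞). -/
theorem convexOn_timeCost_div_rpow (τ₀ ΛT ΛP ΛF lam : ℝ)
    (hτ : 0 ≤ τ₀) (hT : 0 ≤ ΛT) (hP : 0 ≤ ΛP) (hF : 0 < ΛF) (hlam : 0 < lam) :
    ConvexOn ℝ (Set.Ioi (0 : ℝ))
      (fun k : ℝ => (τ₀ + ΛT * k + (1 / lam) * Real.exp (ΛF * k)
        + ΛP * k * Real.exp (ΛF * k)) / k ^ ((4 : ℝ) / 3)) := by
  have h43 : (0 : ℝ) ≤ 4 / 3 := by norm_num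
  have h13 : (0 : ℝ) ≤ 1 / 3 := by norm_num
  refine (((((convexOn_exp_mul_rpow_neg 0 h43).smul hτ).add
    ((convexOn_exp_mul_rpow_neg 0 h13).smul hT)).add
    ((convexOn_exp_mul_rpow_neg ΛF h43).smul (one_div_pos.2 hlam).le)).add
    ((convexOn_exp_mul_rpow_neg ΛF h13).smul hP)).congr fun k hk => ?_
  have hsplit : k ^ (-(1 / 3) : ℝ) = k * k ^ (-(4 / 3) : ℝ) := by
    rw [← Real.rpow_one_add' (le_of_lt hk) (by norm_num)]
    norm_num
  simp only [Pi.add_apply, smul_eq_mul, zero_mul, Real.exp_zero, hsplit,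
    Real.rpow_neg (le_of_lt hk)]
  ring
end

section
/- Let τ₀ ≥ 0, Λ_T ≥ 0, Λ_P ≥ 0, Λ_F > 0, λ > 0, Λ_A ≥ 0, Λ_B ≥ 0, d > 0 and Y > 0 be real constants, and let h(k) = τ₀ + Λ_T·k + (1/λ)·exp(Λ_F·k) + Λ_P·k·exp(Λ_F·k). Then the function J²(k) = (Λ_A²/Y)·h(k) + (16·Λ_B²·d⁴/Y²)·(h(k)/k²)² + (8·Λ_A·Λ_B·d²/Y^(3/2))·(h(k)/k^(4/3))^(3/2) is convex on the interval (0, ∞) (in particular on the constraint set {k : 0 < k ≤ d}). -/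
open Real Set

/-- A convex function postcomposed with a nondecreasing convex function on a set containing its
range is convex. -/
theorem ConvexOn.comp_of_mapsTo {s t : Set ℝ} {f g : ℝ → ℝ} (hg : ConvexOn ℝ t g)
    (hf : ConvexOn ℝ s f) (hmono : MonotoneOn g t) (hst : MapsTo f s t) :
    ConvexOn ℝ s (fun x => g (f x)) := by
  refine ⟨hf.1, fun x hx y hy a b ha hb hab => ?_⟩
  exact (hmono (hst (hf.1 hx hy ha hb hab)) (hg.1 (hst hx) (hst hy) ha hb hab)
    (hf.2 hx hy ha hb hab)).trans (hg.2 (hst hx) (hst hy) ha hb hab)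

theorem convexOn_const_mul_id (c : ℝ) {s : Set ℝ} (hs : Convex ℝ s) :
    ConvexOn ℝ s (fun x => c * x) :=
  (LinearMap.mulLeft ℝ c).convexOn hs

/-- For a nonpositive exponent `c`, the function `x ^ c * exp (F * x)` is log-convex, hence
convex, on the positive reals. -/
theorem convexOn_rpow_mul_exp {c : ℝ} (hc : c ≤ 0) (F : ℝ) :
    ConvexOn ℝ (Ioi 0) (fun x : ℝ => x ^ c * exp (F * x)) := by
  have hlog : ConvexOn ℝ (Ioi 0) (fun x : ℝ => (-c) * (-log x) + F * x) :=
    (strictConcaveOn_log_Ioi.concaveOn.neg.smul (neg_nonneg.2 hc)).add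
      (convexOn_const_mul_id F (convex_Ioi 0))
  refine (convexOn_exp.comp_of_mapsTo hlog (exp_monotone.monotoneOn _)
    (mapsTo_univ _ _)).congr fun x hx => ?_
  have hx : 0 < x := hx
  simp only [rpow_def_of_pos hx, ← exp_add]
  ring_nf

/-- The expected time cost of one global iteration is convex. -/
theorem convexOn_iteration_cost {τ T P F L : ℝ} (hP : 0 ≤ P) (hF : 0 ≤ F) (hL : 0 ≤ L) :
    ConvexOn ℝ (Ioi 0)
      (fun k : ℝ => τ + T * k + L * exp (F * k) + P * k * exp (F * k)) := by
  have hexp : ConvexOn ℝ (Ioi 0) (fun k : ℝ => exp (F * k)) :=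
    convexOn_exp.comp_of_mapsTo (convexOn_const_mul_id F (convex_Ioi 0))
      (exp_monotone.monotoneOn _) (mapsTo_univ _ _)
  have hmul : ConvexOn ℝ (Ioi 0) (fun k : ℝ => P * k * exp (F * k)) :=
    (convexOn_const_mul_id P (convex_Ioi 0)).mul hexp
      (fun x hx => mul_nonneg hP (le_of_lt hx)) (fun x _ => (exp_pos _).le)
      ((Monotone.monovary (fun x y hxy => by gcongr)
        (fun x y hxy => by gcongr)).monovaryOn _)
  exact (((convexOn_const τ (convex_Ioi 0)).add
    (convexOn_const_mul_id T (convex_Ioi 0))).add (hexp.smul hL)).add hmul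

/-- The iteration cost divided by a power `k ^ p` with `1 ≤ p` is convex. -/
theorem convexOn_iteration_cost_div_rpow {τ T P F L p : ℝ} (hτ : 0 ≤ τ) (hT : 0 ≤ T)
    (hP : 0 ≤ P) (hL : 0 ≤ L) (hp : 1 ≤ p) :
    ConvexOn ℝ (Ioi 0)
      (fun k : ℝ => (τ + T * k + L * exp (F * k) + P * k * exp (F * k)) / k ^ p) := by
  have hneg : -p ≤ 0 := by linarith
  have hone : 1 - p ≤ 0 := by linarith
  refine (((((convexOn_rpow_mul_exp hneg 0).smul hτ).add
    ((convexOn_rpow_mul_exp hone 0).smul hT)).add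
    ((convexOn_rpow_mul_exp hneg F).smul hL)).add
    ((convexOn_rpow_mul_exp hone F).smul hP)).congr fun k hk => ?_
  have hk : 0 < k := hk
  have := (rpow_pos_of_pos hk p).ne'
  simp only [Pi.add_apply, smul_eq_mul, zero_mul, exp_zero, mul_one, rpow_neg hk.le,
    rpow_sub hk, rpow_one]
  field_simp

/-- With h(k) = τ₀ + Λ_T·k + (1/λ)·exp(Λ_F·k) + Λ_P·k·exp(Λ_F·k),
the squared objective
J²(k) = (Λ_A²/Y)·h(k) + (16Λ_B²d⁴/Y²)·(h(k)/k²)² + (8Λ_AΛ_Bd²/Y^(3/2))·(h(k)/k^(4/3))^(3/2)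
is convex on (0, ∞). -/
theorem convexOn_Jsq_in_k (τ₀ ΛT ΛP ΛF lam ΛA ΛB d Y : ℝ)
    (hτ : 0 ≤ τ₀) (hT : 0 ≤ ΛT) (hP : 0 ≤ ΛP) (hF : 0 < ΛF) (hlam : 0 < lam)
    (hA : 0 ≤ ΛA) (hB : 0 ≤ ΛB) (hd : 0 < d) (hY : 0 < Y) :
    ConvexOn ℝ (Set.Ioi (0 : ℝ)) (fun k : ℝ =>
      (ΛA ^ 2 / Y) *
          (τ₀ + ΛT * k + (1 / lam) * Real.exp (ΛF * k) + ΛP * k * Real.exp (ΛF * k))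
        + (16 * ΛB ^ 2 * d ^ 4 / Y ^ 2) *
          ((τ₀ + ΛT * k + (1 / lam) * Real.exp (ΛF * k) + ΛP * k * Real.exp (ΛF * k))
            / k ^ 2) ^ 2
        + (8 * ΛA * ΛB * d ^ 2 / Y ^ ((3 : ℝ) / 2)) *
          ((τ₀ + ΛT * k + (1 / lam) * Real.exp (ΛF * k) + ΛP * k * Real.exp (ΛF * k))
            / k ^ ((4 : ℝ) / 3)) ^ ((3 : ℝ) / 2)) := by
  have hL : 0 ≤ 1 / lam := by positivity
  have hcost : ∀ k ∈ Ioi (0 : ℝ),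
      0 ≤ τ₀ + ΛT * k + (1 / lam) * exp (ΛF * k) + ΛP * k * exp (ΛF * k) := by
    intro k hk
    have hk : 0 < k := hk
    positivity
  have hsq := convexOn_iteration_cost_div_rpow (F := ΛF) hτ hT hP hL one_le_two
  simp only [rpow_two] at hsq
  have hdiv := convexOn_iteration_cost_div_rpow (F := ΛF) (p := 4 / 3) hτ hT hP hL (by norm_num)
  have hpow := hsq.pow (fun k hk => div_nonneg (hcost k hk) (sq_nonneg k)) 2
  have hrpow := (convexOn_rpow (p := 3 / 2) (by norm_num)).comp_of_mapsTo hdiv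
    (monotoneOn_rpow_Ici_of_exponent_nonneg (by norm_num))
    (fun k hk => div_nonneg (hcost k hk) (rpow_nonneg (le_of_lt hk) _))
  exact (((convexOn_iteration_cost hP hF.le hL).smul (by positivity)).add
    (hpow.smul (by positivity))).add (hrpow.smul (by positivity))
end

section
/- Let c₀ ≥ 0, c₁ ≥ 0, b > 0, A ≥ 0, B ≥ 0 and C ≥ 0 be real constants, and let h(λ) = c₀ + (1/λ)·exp(b·λ) + c₁·exp(b·λ). Then the function λ ↦ A·h(λ) + B·h(λ)² + C·h(λ)^(3/2) is convex on the interval (0, ∞). -/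
/-- A real power with exponent at least one of a nonnegative convex function is convex. -/
theorem ConvexOn.rpow_of_nonneg {E : Type*} [AddCommGroup E] [Module ℝ E]
    {s : Set E} {f : E → ℝ} (hf : ConvexOn ℝ s f)
    (hf₀ : ∀ x ∈ s, 0 ≤ f x) {p : ℝ} (hp : 1 ≤ p) : ConvexOn ℝ s fun x => f x ^ p :=
  ⟨hf.1, fun x hx y hy _ _ ha hb hab =>
    (Real.rpow_le_rpow (hf₀ _ (hf.1 hx hy ha hb hab)) (hf.2 hx hy ha hb hab)
      (zero_le_one.trans hp)).trans
      ((convexOn_rpow hp).2 (hf₀ x hx) (hf₀ y hy) ha hb hab)⟩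

/-- The exponential of a convex function is convex. -/
theorem ConvexOn.real_exp {E : Type*} [AddCommGroup E] [Module ℝ E]
    {s : Set E} {f : E → ℝ} (hf : ConvexOn ℝ s f) :
    ConvexOn ℝ s fun x => Real.exp (f x) :=
  ⟨hf.1, fun _ hx _ hy _ _ ha hb hab =>
    (Real.exp_le_exp.2 (hf.2 hx hy ha hb hab)).trans
      (convexOn_exp.2 (Set.mem_univ _) (Set.mem_univ _) ha hb hab)⟩

theorem convexOn_const_mul_Ioi (b : ℝ) : ConvexOn ℝ (Set.Ioi (0 : ℝ)) fun x => b * x :=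
  (LinearMap.mulLeft ℝ b).convexOn (convex_Ioi 0)

/-- The function `exp (b * x) / x = exp (b * x - log x)` is convex on the positive reals. -/
theorem convexOn_one_div_mul_exp (b : ℝ) :
    ConvexOn ℝ (Set.Ioi (0 : ℝ)) fun x => 1 / x * Real.exp (b * x) := by
  refine ((convexOn_const_mul_Ioi b).sub strictConcaveOn_log_Ioi.concaveOn).real_exp.congr ?_
  intro x hx
  simp only [Pi.sub_apply]
  rw [Real.exp_sub, Real.exp_log hx]
  ring

/-- With h(λ) = c₀ + (1/λ)·exp(b·λ) + c₁·exp(b·λ), the function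
λ ↦ A·h(λ) + B·h(λ)² + C·h(λ)^(3/2) is convex on (0, ∞). -/
theorem convexOn_Jsq_in_lam (c₀ c₁ b A B C : ℝ)
    (hc₀ : 0 ≤ c₀) (hc₁ : 0 ≤ c₁) (hb : 0 < b) (hA : 0 ≤ A) (hB : 0 ≤ B) (hC : 0 ≤ C) :
    ConvexOn ℝ (Set.Ioi (0 : ℝ)) (fun lam : ℝ =>
      A * (c₀ + (1 / lam) * Real.exp (b * lam) + c₁ * Real.exp (b * lam))
        + B * (c₀ + (1 / lam) * Real.exp (b * lam) + c₁ * Real.exp (b * lam)) ^ 2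
        + C * (c₀ + (1 / lam) * Real.exp (b * lam) + c₁ * Real.exp (b * lam))
            ^ ((3 : ℝ) / 2)) := by
  have hconv : ConvexOn ℝ (Set.Ioi (0 : ℝ)) fun x =>
      c₀ + 1 / x * Real.exp (b * x) + c₁ * Real.exp (b * x) :=
    ((convexOn_const c₀ (convex_Ioi 0)).add (convexOn_one_div_mul_exp b)).add
      ((convexOn_const_mul_Ioi b).real_exp.smul hc₁)
  have hnonneg : ∀ x ∈ Set.Ioi (0 : ℝ),
      0 ≤ c₀ + 1 / x * Real.exp (b * x) + c₁ * Real.exp (b * x) := by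
    intro x (hx : 0 < x)
    positivity
  exact ((hconv.smul hA).add ((hconv.pow hnonneg 2).smul hB)).add
    ((hconv.rpow_of_nonneg hnonneg (by norm_num)).smul hC)
end

section
/- Let E be a real normed vector space, γ ∈ (0, 1] and B ≥ 0 real numbers, and (m_t)_{t ∈ ℕ} a sequence in E with m_0 = 0 satisfying ‖m_{t+1}‖ ≤ √(1−γ) · (‖m_t‖ + B) for all t. Then ‖m_t‖ ≤ 2·√(1−γ)·B/γ for all t, and consequently ‖m_t‖² ≤ 4·(1−γ)·B²/γ². -/
/-- Error-feedback memory bound (Lemma 1, deterministic core):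
if m₀ = 0 and ‖m_{t+1}‖ ≤ √(1−γ)·(‖m_t‖ + B) for all t with γ ∈ (0,1] and B ≥ 0,
then ‖m_t‖ ≤ 2√(1−γ)B/γ and ‖m_t‖² ≤ 4(1−γ)B²/γ² for all t. -/
theorem memory_norm_bound {E : Type*} [NormedAddCommGroup E] [NormedSpace ℝ E]
    (γ B : ℝ) (hγ : γ ∈ Set.Ioc (0 : ℝ) 1) (hB : 0 ≤ B)
    (m : ℕ → E) (hm0 : m 0 = 0)
    (hrec : ∀ t, ‖m (t + 1)‖ ≤ Real.sqrt (1 - γ) * (‖m t‖ + B)) :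
    (∀ t, ‖m t‖ ≤ 2 * Real.sqrt (1 - γ) * B / γ) ∧
      (∀ t, ‖m t‖ ^ 2 ≤ 4 * (1 - γ) * B ^ 2 / γ ^ 2) := by
  obtain ⟨hγ0, hγ1⟩ := hγ
  have hs : 0 ≤ Real.sqrt (1 - γ) := Real.sqrt_nonneg _
  have hle : Real.sqrt (1 - γ) ≤ 1 - γ / 2 :=
    Real.sqrt_le_iff.mpr ⟨by linarith, by nlinarith [sq_nonneg γ]⟩
  have hbound : ∀ t, ‖m t‖ ≤ 2 * Real.sqrt (1 - γ) * B / γ := by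
    intro t
    induction t with
    | zero =>
      rw [hm0, norm_zero]
      positivity
    | succ t ih =>
      calc ‖m (t + 1)‖ ≤ Real.sqrt (1 - γ) * (‖m t‖ + B) := hrec t
        _ ≤ Real.sqrt (1 - γ) * (2 * Real.sqrt (1 - γ) * B / γ + B) := by gcongr
        _ = Real.sqrt (1 - γ) * B * (2 * Real.sqrt (1 - γ) + γ) / γ := by
          field_simp
        _ ≤ Real.sqrt (1 - γ) * B * 2 / γ := by
          gcongr
          linarith
        _ = 2 * Real.sqrt (1 - γ) * B / γ := by ring
  refine ⟨hbound, fun t => ?_⟩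
  calc ‖m t‖ ^ 2 ≤ (2 * Real.sqrt (1 - γ) * B / γ) ^ 2 := by
        gcongr
        exact hbound t
    _ = 4 * Real.sqrt (1 - γ) ^ 2 * B ^ 2 / γ ^ 2 := by ring
    _ = 4 * (1 - γ) * B ^ 2 / γ ^ 2 := by rw [Real.sq_sqrt (by linarith)]
end
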